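/- arXiv:2008.02422 — 7 statements merged into one kernel-verified Lean document; each statement's English description precedes it below -/
import Mathlib

section
/- Let p be an odd prime, G a finite abelian group, and σ an element of G. Then σ + 1 is a unit of the group algebra 𝔽_p[G] if and only if the order of σ is odd. -/
/-- Lemma 7.1: for an odd prime `p`, a finite abelian group `G` and `σ ∈ G`,
the element `σ + 1` of the group algebra `𝔽_p[G]` is a unit iff the order of `σ` is odd. -/
theorem stmt0 (p : ℕ) (hp : p.Prime) (hodd : Odd p)
    (G : Type*) [CommGroup G] [Finite G] (σ : G) :
    IsUnit (MonoidAlgebra.of (ZMod p) G σ + 1) ↔ Odd (orderOf σ) := by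
  have : Fact p.Prime := ⟨hp⟩
  have hpow : MonoidAlgebra.of (ZMod p) G σ ^ orderOf σ = 1 := by
    rw [← map_pow, pow_orderOf_eq_one, map_one]
  constructor
  · intro hu
    by_contra hn
    rw [Nat.not_odd_iff_even] at hn
    have hgeom : ∑ i ∈ Finset.range (orderOf σ), (-MonoidAlgebra.of (ZMod p) G σ) ^ i = 0 := by
      have h := geom_sum_mul (-MonoidAlgebra.of (ZMod p) G σ) (orderOf σ)
      rw [hn.neg_pow, hpow, sub_self, ← neg_add', mul_neg, neg_eq_zero] at h
      exact hu.mul_left_eq_zero.mp h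
    have hterm (i : ℕ) : (-MonoidAlgebra.of (ZMod p) G σ) ^ i =
        MonoidAlgebra.single (σ ^ i) ((-1 : ZMod p) ^ i) := by
      rw [MonoidAlgebra.of_apply, ← MonoidAlgebra.single_neg, MonoidAlgebra.single_pow]
    simp_rw [hterm] at hgeom
    have hcoeff := congrArg (fun f => f.coeff 1) hgeom
    simp only [MonoidAlgebra.coeff_sum, MonoidAlgebra.coeff_single, Finsupp.finsetSum_apply,
      MonoidAlgebra.coeff_zero, Finsupp.zero_apply] at hcoeff
    rw [Finset.sum_eq_single_of_mem 0 (Finset.mem_range.mpr (orderOf_pos σ))] at hcoeff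
    · simp at hcoeff
    · intro i hi hi0
      exact Finsupp.single_eq_of_ne'
        (pow_ne_one_of_lt_orderOf hi0 (Finset.mem_range.mp hi))
  · intro hn
    have hdvd := hn.add_dvd_pow_add_pow (MonoidAlgebra.of (ZMod p) G σ) 1
    rw [hpow, one_pow, one_add_one_eq_two] at hdvd
    have htwo : IsUnit (2 : ZMod p) := by
      rw [← Nat.cast_ofNat, ZMod.isUnit_iff_coprime]
      exact hodd.coprime_two_left
    refine isUnit_of_dvd_unit hdvd ?_
    have h := htwo.map (algebraMap (ZMod p) (MonoidAlgebra (ZMod p) G))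
    rwa [map_ofNat] at h
end

section
/- Let p be an odd prime and m a positive integer coprime to p. Let h be the multiplicative order of p modulo m, i.e. the order of the unit determined by p in (ℤ/mℤ)ˣ, and let σ_p ∈ (ℤ/mℤ)ˣ denote this unit. Let α be a unit of ℤ_p such that α^h ≢ 1 (mod p). Then both σ_p − α and σ_p − α⁻¹ are units of the group algebra ℤ_p[(ℤ/mℤ)ˣ]. -/
theorem isUnit_sub_algebraMap_of_pow_eq_one {R A : Type*} [CommRing R] [CommRing A] [Algebra R A]
    {s : A} {a : R} {n : ℕ} (hs : s ^ n = 1) (ha : IsUnit (a ^ n - 1)) :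
    IsUnit (s - algebraMap R A a) := by
  refine isUnit_of_dvd_unit (sub_dvd_pow_sub_pow s (algebraMap R A a) n) ?_
  simpa [hs] using (ha.map (algebraMap R A)).neg

theorem PadicInt.isUnit_iff_not_dvd {p : ℕ} [Fact p.Prime] {x : ℤ_[p]} :
    IsUnit x ↔ ¬ (p : ℤ_[p]) ∣ x := by
  rw [← PadicInt.norm_lt_one_iff_dvd, ← PadicInt.not_isUnit_iff, not_not]

theorem Units.isUnit_inv_pow_sub_one {R : Type*} [CommRing R] {u : Rˣ} {n : ℕ}
    (hu : IsUnit ((u : R) ^ n - 1)) : IsUnit (((u⁻¹ : Rˣ) : R) ^ n - 1) := by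
  have h : ((u⁻¹ : Rˣ) : R) ^ n * (u : R) ^ n = 1 := by rw [← mul_pow, Units.inv_mul, one_pow]
  have key : ((u⁻¹ : Rˣ) : R) ^ n - 1 = -(((u⁻¹ : Rˣ) : R) ^ n * ((u : R) ^ n - 1)) := by
    linear_combination h
  rw [key]
  exact ((u⁻¹.isUnit.pow n).mul hu).neg

/-- Lemma 3.15 / Proposition 2.5: let `p` be an odd prime, `m` a positive integer coprime
to `p`, `σ_p` the unit of `ℤ/mℤ` determined by `p`, `h` its multiplicative order, and `α`
a unit of `ℤ_p` with `α ^ h ≢ 1 (mod p)`.  Then `σ_p - α` and `σ_p - α⁻¹` are units of the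
group algebra `ℤ_p[(ℤ/mℤ)ˣ]`. -/
theorem stmt1 (p : ℕ) [Fact p.Prime] (hodd : Odd p)
    (m : ℕ) (hm : 0 < m) (hcop : Nat.Coprime p m)
    (α : ℤ_[p]ˣ)
    (hα : ¬ ((p : ℤ_[p]) ∣
      ((α : ℤ_[p]) ^ (orderOf (ZMod.unitOfCoprime p hcop)) - 1))) :
    IsUnit (MonoidAlgebra.of ℤ_[p] (ZMod m)ˣ (ZMod.unitOfCoprime p hcop)
        - algebraMap ℤ_[p] (MonoidAlgebra ℤ_[p] (ZMod m)ˣ) (α : ℤ_[p]))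
    ∧ IsUnit (MonoidAlgebra.of ℤ_[p] (ZMod m)ˣ (ZMod.unitOfCoprime p hcop)
        - algebraMap ℤ_[p] (MonoidAlgebra ℤ_[p] (ZMod m)ˣ) ((α⁻¹ : ℤ_[p]ˣ) : ℤ_[p])) := by
  have hs : MonoidAlgebra.of ℤ_[p] (ZMod m)ˣ (ZMod.unitOfCoprime p hcop)
      ^ orderOf (ZMod.unitOfCoprime p hcop) = 1 := by
    rw [← map_pow, pow_orderOf_eq_one, map_one]
  have hu := PadicInt.isUnit_iff_not_dvd.2 hα
  exact ⟨isUnit_sub_algebraMap_of_pow_eq_one hs hu,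
    isUnit_sub_algebraMap_of_pow_eq_one hs (Units.isUnit_inv_pow_sub_one hu)⟩
end

section
/- Let p be an odd prime, G a finite abelian group, Λ := ℤ_p[[T]] and ℛ := Λ[G]. For n ≥ 0 let J_n be the ideal of ℛ generated by p^n and (1+T)^{p^n} − 1. Let X be a finitely generated ℛ-module which is free as a Λ-module. Then the natural map Hom_ℛ(X, ℛ) → Hom_{ℛ/J_n}(X/J_nX, ℛ/J_n) is surjective; equivalently, every ℛ-linear map X → ℛ/J_n lifts to an ℛ-linear map X → ℛ. -/
namespace MonoidAlgebra

theorem mem_map_algebraMap_iff {A M : Type*} [CommRing A] [CommMonoid M] (I : Ideal A)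
    (x : MonoidAlgebra A M) :
    x ∈ I.map (algebraMap A (MonoidAlgebra A M)) ↔ ∀ k, x.coeff k ∈ I := by
  constructor
  · intro hx
    induction hx using Submodule.span_induction with
    | mem y hy =>
      obtain ⟨a, ha, rfl⟩ := hy
      intro k
      classical
      rw [coe_algebraMap, Function.comp_apply, coeff_single, Finsupp.single_apply]
      split_ifs
      · exact ha
      · exact I.zero_mem
    | zero => simp
    | add y z _ _ hy hz => exact fun k => I.add_mem (hy k) (hz k)
    | smul r y _ hy =>
      intro k
      classical
      rw [smul_eq_mul, coeff_mul]
      refine I.sum_mem fun m _ => I.sum_mem fun l _ => ?_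
      dsimp only
      split_ifs
      · exact I.mul_mem_left _ (hy l)
      · exact I.zero_mem
  · intro hx
    rw [← sum_coeff_single x]
    refine Ideal.sum_mem _ fun k _ => ?_
    rw [single_eq_algebraMap_mul_of]
    exact Ideal.mul_mem_right _ _ (Ideal.mem_map_of_mem _ (hx k))

/-- The `A[G]`-linear map `X → A[G]` attached to an `A`-linear form `ψ` on an `A[G]`-module `X`,
namely `x ↦ ∑ k, ψ (k⁻¹ x) k`. -/
noncomputable def coinducedLift {A G X : Type*} [CommRing A] [Group G] [Fintype G]
    [AddCommGroup X] [Module A X] [Module (MonoidAlgebra A G) X]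
    [IsScalarTower A (MonoidAlgebra A G) X] (ψ : X →ₗ[A] A) :
    X →ₗ[MonoidAlgebra A G] MonoidAlgebra A G :=
  equivariantOfLinearOfComm
    (∑ k : G, lsingle k ∘ₗ ψ ∘ₗ Algebra.lsmul A A X (single k⁻¹ (1 : A)))
    (fun g v => by
      simp only [LinearMap.sum_apply, LinearMap.comp_apply, lsingle_apply, Algebra.lsmul_coe,
        smul_eq_mul, Finset.mul_sum, single_mul_single, one_mul, smul_smul]
      refine Fintype.sum_equiv (Equiv.mulLeft g⁻¹) _ _ fun k => ?_
      simp)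

theorem coeff_coinducedLift {A G X : Type*} [CommRing A] [Group G] [Fintype G]
    [AddCommGroup X] [Module A X] [Module (MonoidAlgebra A G) X]
    [IsScalarTower A (MonoidAlgebra A G) X] (ψ : X →ₗ[A] A) (x : X) (k : G) :
    (coinducedLift ψ x : MonoidAlgebra A G).coeff k = ψ (single k⁻¹ (1 : A) • x) := by
  classical
  simp [coinducedLift, Finsupp.finsetSum_apply, Finsupp.single_apply]

/-- Over a finite group, linear maps into `A[G] / I A[G]` from a module which is projective over
`A` lift to `A[G]`. -/
theorem exists_lift_of_projective {A G X : Type*} [CommRing A] [CommGroup G] [Finite G]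
    [AddCommGroup X] [Module A X] [Module (MonoidAlgebra A G) X]
    [IsScalarTower A (MonoidAlgebra A G) X] [Module.Projective A X] (I : Ideal A)
    (g : X →ₗ[MonoidAlgebra A G]
      (MonoidAlgebra A G ⧸ I.map (algebraMap A (MonoidAlgebra A G)))) :
    ∃ f : X →ₗ[MonoidAlgebra A G] MonoidAlgebra A G,
      ∀ x : X, Ideal.Quotient.mk (I.map (algebraMap A (MonoidAlgebra A G))) (f x) = g x := by
  have := Fintype.ofFinite G
  let J := I.map (algebraMap A (MonoidAlgebra A G))
  obtain ⟨h, hh⟩ := Module.projective_lifting_property (Ideal.Quotient.mkₐ A J).toLinearMap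
    (g.restrictScalars A) (Ideal.Quotient.mkₐ_surjective A J)
  replace hh (x : X) : Ideal.Quotient.mk J (h x) = g x := LinearMap.congr_fun hh x
  refine ⟨coinducedLift ((Finsupp.lapply 1 ∘ₗ (coeffLinearEquiv A).toLinearMap) ∘ₗ h),
    fun x => ?_⟩
  refine Eq.trans ?_ (hh x)
  rw [Ideal.Quotient.mk_eq_mk_iff_sub_mem, mem_map_algebraMap_iff]
  intro k
  have key : h (single k⁻¹ (1 : A) • x) - single k⁻¹ (1 : A) * h x ∈ J := by
    rw [← Ideal.Quotient.mk_eq_mk_iff_sub_mem, hh, map_smul, map_mul, hh]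
    rfl
  have := (mem_map_algebraMap_iff I _).1 key 1
  simpa [coeff_coinducedLift] using this

end MonoidAlgebra

/-- Lemma 6.2 (lem:781): for `ℛ = Λ[G]` with `Λ = ℤ_p[[T]]`, `J_n = (p^n, (1+T)^{p^n} − 1)`,
and a finitely generated `ℛ`-module `X` which is free over `Λ`, every `ℛ`-linear map
`X → ℛ/J_n` lifts to an `ℛ`-linear map `X → ℛ` (equivalently, the natural map
`Hom_ℛ(X, ℛ) → Hom_{ℛ/J_n}(X/J_nX, ℛ/J_n)` is surjective). -/
theorem stmt8 (p : ℕ) [Fact p.Prime] (hodd : Odd p)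
    (G : Type*) [CommGroup G] [Finite G] (n : ℕ)
    (X : Type*) [AddCommGroup X]
    [Module (MonoidAlgebra (PowerSeries ℤ_[p]) G) X]
    [Module.Finite (MonoidAlgebra (PowerSeries ℤ_[p]) G) X]
    [Module (PowerSeries ℤ_[p]) X]
    [IsScalarTower (PowerSeries ℤ_[p]) (MonoidAlgebra (PowerSeries ℤ_[p]) G) X]
    [Module.Free (PowerSeries ℤ_[p]) X]
    (J : Ideal (MonoidAlgebra (PowerSeries ℤ_[p]) G))
    (hJ : J = Ideal.span
      { (p : MonoidAlgebra (PowerSeries ℤ_[p]) G) ^ n,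
        algebraMap (PowerSeries ℤ_[p]) (MonoidAlgebra (PowerSeries ℤ_[p]) G)
          ((1 + PowerSeries.X) ^ (p ^ n) - 1) })
    (g : X →ₗ[MonoidAlgebra (PowerSeries ℤ_[p]) G]
        (MonoidAlgebra (PowerSeries ℤ_[p]) G ⧸ J)) :
    ∃ f : X →ₗ[MonoidAlgebra (PowerSeries ℤ_[p]) G] MonoidAlgebra (PowerSeries ℤ_[p]) G,
      ∀ x : X, Ideal.Quotient.mk J (f x) = g x := by
  have hJ' : J = (Ideal.span {(p : PowerSeries ℤ_[p]) ^ n,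
      (1 + PowerSeries.X) ^ (p ^ n) - 1}).map
        (algebraMap (PowerSeries ℤ_[p]) (MonoidAlgebra (PowerSeries ℤ_[p]) G)) := by
    rw [hJ, Ideal.map_span, Set.image_pair, map_pow, map_natCast]
  subst hJ'
  exact MonoidAlgebra.exists_lift_of_projective _ g
end

section
/- Let p be an odd prime, G a finite abelian group, and ℛ := ℤ_p[G][[T]]. If g ∈ ℛ is a non-zero-divisor, then the quotient module ℛ/gℛ contains no nonzero finite ℛ-submodule; that is, every ℛ-submodule of ℛ/gℛ of finite cardinality is zero. -/
theorem PowerSeries.eq_zero_of_natCast_mul_eq_zero {R G : Type*} [CommRing R] [IsDomain R]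
    [CharZero R] [CommGroup G] {n : ℕ} (hn : n ≠ 0) {x : PowerSeries (MonoidAlgebra R G)}
    (hx : (n : PowerSeries (MonoidAlgebra R G)) * x = 0) : x = 0 := by
  ext j s
  have h := congrArg (fun y => (PowerSeries.coeff j y).coeff s) hx
  simp only [← nsmul_eq_mul, map_nsmul, MonoidAlgebra.coeff_smul_apply, map_zero] at h
  simpa [hn] using h

/-- If a natural number divides `X ^ i * a`, then it divides `a`. -/
theorem PowerSeries.natCast_dvd_of_dvd_X_pow_mul {A : Type*} [CommRing A] {n i : ℕ}
    {a b : PowerSeries A} (h : PowerSeries.X ^ i * a = (n : PowerSeries A) * b) :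
    ∃ c, a = (n : PowerSeries A) * c := by
  refine ⟨PowerSeries.mk fun j => PowerSeries.coeff (j + i) b, ?_⟩
  ext j
  have hj := congrArg (PowerSeries.coeff (j + i)) h
  rw [PowerSeries.coeff_X_pow_mul, ← nsmul_eq_mul, map_nsmul] at hj
  rw [hj, ← nsmul_eq_mul, map_nsmul, PowerSeries.coeff_mk]

/-- Every element of a finite module over a power series ring is killed by a power of `X`. -/
theorem PowerSeries.exists_X_pow_smul_eq_zero {A M : Type*} [CommRing A] [AddCommGroup M]
    [Module (PowerSeries A) M] [Finite M] (m : M) :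
    ∃ i : ℕ, (PowerSeries.X ^ i : PowerSeries A) • m = 0 := by
  obtain ⟨i, j, hij, h⟩ := Set.finite_univ.exists_lt_map_eq_of_forall_mem
    (f := fun i : ℕ => (PowerSeries.X ^ i : PowerSeries A) • m) fun _ => Set.mem_univ _
  refine ⟨i, ?_⟩
  have hu : IsUnit (1 - PowerSeries.X ^ (j - i) : PowerSeries A) := by
    rw [PowerSeries.isUnit_iff_constantCoeff]
    simp [Nat.sub_ne_zero_of_lt hij]
  rw [← hu.smul_eq_zero, smul_smul, sub_mul, one_mul, ← pow_add,
    Nat.sub_add_cancel hij.le, sub_smul, h, sub_self]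

/-- From the proof of Lemma A.9 (lem:109): for `ℛ = ℤ_p[G][[T]]` and a non-zero-divisor
`g ∈ ℛ`, the quotient `ℛ/gℛ` contains no nonzero finite `ℛ`-submodule. -/
theorem stmt9 (p : ℕ) [Fact p.Prime] (hodd : Odd p)
    (G : Type*) [CommGroup G] [Finite G]
    (g : PowerSeries (MonoidAlgebra ℤ_[p] G))
    (hg : g ∈ nonZeroDivisors (PowerSeries (MonoidAlgebra ℤ_[p] G)))
    (N : Submodule (PowerSeries (MonoidAlgebra ℤ_[p] G))
      (PowerSeries (MonoidAlgebra ℤ_[p] G) ⧸ Ideal.span {g}))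
    (hN : Finite N) : N = ⊥ := by
  rw [Submodule.eq_bot_iff]
  intro y hy
  obtain ⟨x, rfl⟩ := Ideal.Quotient.mk_surjective y
  have hn : Nat.card N ≠ 0 := Nat.card_pos.ne'
  generalize hcard : Nat.card N = n at hn
  have hnx : (n : PowerSeries (MonoidAlgebra ℤ_[p] G)) * x ∈ Ideal.span {g} := by
    have h : Nat.card N • (⟨_, hy⟩ : N) = 0 := card_nsmul_eq_zero'
    rw [hcard] at h
    rw [← Ideal.Quotient.eq_zero_iff_mem, ← nsmul_eq_mul, map_nsmul]
    exact congrArg Subtype.val h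
  obtain ⟨i, hi⟩ := PowerSeries.exists_X_pow_smul_eq_zero (A := MonoidAlgebra ℤ_[p] G)
    (⟨_, hy⟩ : N)
  have hix : PowerSeries.X ^ i * x ∈ Ideal.span {g} := by
    rw [← Ideal.Quotient.eq_zero_iff_mem]
    exact congrArg Subtype.val hi
  obtain ⟨a, ha⟩ := Ideal.mem_span_singleton'.1 hnx
  obtain ⟨b, hb⟩ := Ideal.mem_span_singleton'.1 hix
  have hab : PowerSeries.X ^ i * a = (n : PowerSeries (MonoidAlgebra ℤ_[p] G)) * b := by
    rw [← mul_cancel_right_mem_nonZeroDivisors hg]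
    linear_combination PowerSeries.X ^ i * ha - (n : PowerSeries (MonoidAlgebra ℤ_[p] G)) * hb
  obtain ⟨c, rfl⟩ := PowerSeries.natCast_dvd_of_dvd_X_pow_mul hab
  have hxc : x - c * g = 0 := by
    apply PowerSeries.eq_zero_of_natCast_mul_eq_zero hn
    linear_combination -ha
  rw [Ideal.Quotient.eq_zero_iff_mem]
  exact Ideal.mem_span_singleton'.2 ⟨c, (sub_eq_zero.1 hxc).symm⟩
end

section
/- Let p be an odd prime, m a positive integer coprime to p, and n ≥ 0 an integer. Let ζ be a primitive (m·p^{n+1})-th root of unity in the cyclotomic field ℚ(μ_{mp^{n+1}}), let L = ℚ(ζ) and let K = ℚ(ζ^p) (so K = ℚ(μ_{mp^n})). Then the trace map Tr_{L/K} satisfies Tr_{L/K}(ζ^m − 1) = −p. -/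
open Polynomial IntermediateField in
/-- If `x` generates `L` over `K` and is a root of a monic polynomial of degree `[L : K]`, then the
trace of `x` is read off from the second coefficient of that polynomial. -/
theorem trace_eq_neg_nextCoeff_of_monic {K L : Type*} [Field K] [Field L] [Algebra K L]
    [FiniteDimensional K L] {x : L} (hx : K⟮x⟯ = ⊤) {P : K[X]} (hP : P.Monic)
    (hroot : aeval x P = 0) (hdeg : P.natDegree = Module.finrank K L) :
    Algebra.trace K L x = -P.nextCoeff := by
  have hmin : P = minpoly K x :=
    eq_of_monic_of_dvd_of_natDegree_le (minpoly.monic (.of_finite K x)) hP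
      (minpoly.dvd K x hroot)
      (hdeg.trans ((Field.primitive_element_iff_minpoly_natDegree_eq K x).1 hx).symm).le
  rw [trace_eq_finrank_mul_minpoly_nextCoeff, hx, IntermediateField.finrank_top, hmin]
  simp

open IntermediateField in
/-- Adjoining to `ℚ` a primitive `k`-th root of unity gives a field of degree `φ k`. -/
theorem IsPrimitiveRoot.finrank_adjoin_rat {L : Type*} [Field L] [Algebra ℚ L] {ζ : L} {k : ℕ}
    (h : IsPrimitiveRoot ζ k) (hk : 0 < k) : Module.finrank ℚ ℚ⟮ζ⟯ = k.totient := by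
  have : CharZero L := algebraRat.charZero L
  have hmin : minpoly ℚ ζ = Polynomial.cyclotomic k ℚ := by
    convert (Polynomial.cyclotomic_eq_minpoly_rat h hk).symm
    exact Subsingleton.elim _ _
  rw [adjoin.finrank (h.isIntegral hk).tower_top, hmin, Polynomial.natDegree_cyclotomic]

open IntermediateField in
/-- If `a` and `b` are coprime, then `x` lies in any field containing `x ^ a` and `x ^ b`. -/
theorem adjoin_pow_eq_top_of_coprime {F L : Type*} [Field F] [Field L] [Algebra F L] {x : L}
    (hx : x ≠ 0) (hgen : F⟮x⟯ = ⊤) {a b : ℕ} (hab : a.Coprime b) :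
    (F⟮x ^ b⟯)⟮x ^ a⟯ = ⊤ := by
  set E := (F⟮x ^ b⟯)⟮x ^ a⟯
  have ha : x ^ a ∈ E := mem_adjoin_simple_self _ _
  have hb : x ^ b ∈ E := E.algebraMap_mem ⟨x ^ b, mem_adjoin_simple_self F _⟩
  have hxE : x ∈ E := by
    have hbez : (a : ℤ) * a.gcdA b + b * a.gcdB b = 1 := by
      rw [← Nat.gcd_eq_gcd_ab, hab.gcd_eq_one, Nat.cast_one]
    have hprod : (x ^ a) ^ a.gcdA b * (x ^ b) ^ a.gcdB b = x := by
      rw [← zpow_natCast x a, ← zpow_natCast x b, ← zpow_mul, ← zpow_mul, ← zpow_add₀ hx, hbez,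
        zpow_one]
    have hmem := E.mul_mem (zpow_mem ha (a.gcdA b)) (zpow_mem hb (a.gcdB b))
    rwa [hprod] at hmem
  have hle : F⟮x⟯ ≤ E.restrictScalars F := adjoin_simple_le_iff.2 hxE
  rw [hgen] at hle
  exact top_le_iff.1 fun y _ ↦ hle (mem_top (x := y))

open IntermediateField in
/-- The degree of `ℚ(μ_{kp})` over `ℚ(μ_k)`, multiplied by `φ k`, is `φ (p * k)`. -/
theorem IsPrimitiveRoot.totient_mul_finrank_adjoin_pow {L : Type*} [Field L] [Algebra ℚ L]
    {ζ : L} {p k : ℕ} (hζ : IsPrimitiveRoot ζ (p * k)) (hpk : 0 < p * k) (hgen : ℚ⟮ζ⟯ = ⊤) :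
    k.totient * Module.finrank ℚ⟮ζ ^ p⟯ L = (p * k).totient := by
  rw [← (hζ.pow hpk rfl).finrank_adjoin_rat (Nat.pos_of_mul_pos_left hpk),
    Module.finrank_mul_finrank, ← hζ.finrank_adjoin_rat hpk, hgen, finrank_top']


/-- Lemma 3.3(1) (lem:14(1)): for `ζ` a primitive `m·p^{n+1}`-th root of unity,
`L = ℚ(ζ)` and `K = ℚ(ζ^p) = ℚ(μ_{mp^n})`, the trace satisfies
`Tr_{L/K}(ζ^m − 1) = −p`. -/
theorem stmt11 (p : ℕ) [Fact p.Prime] (hodd : Odd p)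
    (m n : ℕ) (hm : 0 < m) (hcop : Nat.Coprime m p)
    (L : Type*) [Field L] [Algebra ℚ L] [FiniteDimensional ℚ L]
    (ζ : L) (hζ : IsPrimitiveRoot ζ (m * p ^ (n + 1)))
    (hgen : IntermediateField.adjoin ℚ {ζ} = ⊤) :
    Algebra.trace (IntermediateField.adjoin ℚ {ζ ^ p}) L (ζ ^ m - 1)
      = - (p : IntermediateField.adjoin ℚ {ζ ^ p}) := by
  have hp : p.Prime := Fact.out
  have hpos : 0 < m * p ^ n := Nat.mul_pos hm (pow_pos hp.pos n)
  have hk : m * p ^ (n + 1) = p * (m * p ^ n) := by ring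
  have hpk : 0 < p * (m * p ^ n) := Nat.mul_pos hp.pos hpos
  have hφ : 0 < (m * p ^ n).totient := Nat.totient_pos.2 hpos
  have hη : IsPrimitiveRoot (ζ ^ m) (p ^ (n + 1)) := hζ.pow (hk ▸ hpk) rfl
  rw [hk] at hζ
  have hdeg := hζ.totient_mul_finrank_adjoin_pow hpk hgen
  have htop := adjoin_pow_eq_top_of_coprime (hζ.ne_zero hpk.ne') hgen hcop
  set K := IntermediateField.adjoin ℚ {ζ ^ p}
  have hone : Algebra.trace K L 1 = Module.finrank K L := by
    simpa using Algebra.trace_algebraMap (S := L) (1 : K)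
  rw [map_sub, hone]
  rcases n with _ | n
  · have hfin : Module.finrank K L = p - 1 := by
      have hpm : ¬ p ∣ m * p ^ 0 := by
        simpa using hp.coprime_iff_not_dvd.1 hcop.symm
      rw [Nat.totient_mul_of_prime_of_not_dvd hp hpm, mul_comm] at hdeg
      exact Nat.eq_of_mul_eq_mul_right hφ hdeg
    rw [zero_add, pow_one] at hη
    have hroot : Polynomial.aeval (ζ ^ m) (Polynomial.cyclotomic p K) = 0 := by
      rw [Polynomial.aeval_def, Polynomial.eval₂_eq_eval_map, Polynomial.map_cyclotomic]
      exact hη.isRoot_cyclotomic hp.pos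
    have hnat : (Polynomial.cyclotomic p K).natDegree = p - 1 := by
      rw [Polynomial.natDegree_cyclotomic, Nat.totient_prime hp]
    have hnext : (Polynomial.cyclotomic p K).nextCoeff = 1 := by
      have := hp.two_le
      rw [Polynomial.nextCoeff_of_natDegree_pos (by omega), hnat, Polynomial.cyclotomic_prime]
      simp [Polynomial.coeff_X_pow]
      omega
    rw [trace_eq_neg_nextCoeff_of_monic htop (Polynomial.cyclotomic.monic p K) hroot
      (hnat.trans hfin.symm), hnext, hfin, Nat.cast_sub hp.one_le, Nat.cast_one]
    ring
  · have hfin : Module.finrank K L = p := by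
      have hpm : p ∣ m * p ^ (n + 1) := Dvd.intro_left (m * p ^ n) (by ring)
      rw [Nat.totient_mul_of_prime_of_dvd hp hpm, mul_comm] at hdeg
      exact Nat.eq_of_mul_eq_mul_right hφ hdeg
    let c : K := ⟨ζ ^ p, IntermediateField.mem_adjoin_simple_self ℚ _⟩ ^ m
    have hroot : Polynomial.aeval (ζ ^ m) (Polynomial.X ^ p - Polynomial.C c) = 0 := by
      have hc : algebraMap K L c = (ζ ^ p) ^ m := rfl
      simp [hc, pow_right_comm]
    have hnat : (Polynomial.X ^ p - Polynomial.C c).natDegree = p :=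
      Polynomial.natDegree_X_pow_sub_C
    have hnext : (Polynomial.X ^ p - Polynomial.C c).nextCoeff = 0 := by
      have := hp.two_le
      rw [Polynomial.nextCoeff_of_natDegree_pos (by omega), hnat, Polynomial.coeff_sub,
        Polynomial.coeff_X_pow, Polynomial.coeff_C, if_neg (by omega), if_neg (by omega), sub_zero]
    rw [trace_eq_neg_nextCoeff_of_monic htop (Polynomial.monic_X_pow_sub_C c hp.ne_zero) hroot
      (hnat.trans hfin.symm), hnext, hfin]
    simp
end

section
/- Let m be a positive integer and ζ a primitive m-th root of unity in the cyclotomic field ℚ(μ_m). Let 𝒜(m) denote the set of divisors m' of m such that m' has the same set of prime divisors as m. Then the ℤ-submodule of ℚ(μ_m) spanned by the elements σ(ζ^{m/m'}), where σ ranges over Gal(ℚ(μ_m)/ℚ) and m' over 𝒜(m), equals the subring ℤ[ζ]. Equivalently, ℤ[μ_m] is generated as a module over the group ring ℤ[Gal(ℚ(μ_m)/ℚ)] by the primitive m'-th roots of unity ζ^{m/m'} for m' ∈ 𝒜(m). -/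
/-- If `p ∣ m` and the exact power of `p` in `m` divides `j`, then translating `j` by `m / p * i`
with `0 < i < p` removes `p`, and no other prime, from the set of primes whose exact power in `m`
divides `j`. -/
theorem filter_ordProj_dvd_add_div_mul {m p i j : ℕ} (hm : 0 < m) (hp : p ∈ m.primeFactors)
    (hpj : p ^ m.factorization p ∣ j) (hi0 : 0 < i) (hip : i < p) :
    (m.primeFactors.filter fun q => q ^ m.factorization q ∣ j + m / p * i) =
      (m.primeFactors.filter fun q => q ^ m.factorization q ∣ j).erase p := by
  have hpp := Nat.prime_of_mem_primeFactors hp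
  have hpm := Nat.dvd_of_mem_primeFactors hp
  ext q
  simp only [Finset.mem_filter, Finset.mem_erase]
  by_cases hq : q = p
  · subst hq
    simp only [ne_eq, not_true_eq_false, false_and, iff_false, not_and]
    intro _ h
    rw [← Nat.dvd_add_iff_right hpj] at h
    obtain ⟨c, hc⟩ := h
    have h1 : q ^ (m.factorization q + 1) ∣ m * i :=
      ⟨c, by rw [← Nat.mul_div_cancel' hpm, mul_assoc, hc,
        Nat.mul_div_cancel' hpm]; ring⟩
    rw [hpp.pow_dvd_iff_le_factorization (by positivity),
      Nat.factorization_mul hm.ne' hi0.ne', Finsupp.add_apply,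
      Nat.factorization_eq_zero_of_lt hip] at h1
    omega
  · simp only [ne_eq, hq, not_false_eq_true, true_and]
    refine and_congr_right fun hqm => ?_
    have hqp := Nat.prime_of_mem_primeFactors hqm
    have h : q ^ m.factorization q ∣ m / p := by
      have h2 : q ^ m.factorization q ∣ p * (m / p) := by
        rw [Nat.mul_div_cancel' hpm]; exact Nat.ordProj_dvd m q
      exact (Nat.Coprime.pow_left _ ((Nat.coprime_primes hqp hpp).2 hq)).dvd_of_dvd_mul_left h2
    exact (Nat.dvd_add_iff_left (h.mul_right i)).symm

/-- If no exact prime power of `m` divides `j`, then `m / gcd(m, j)` has the same prime factors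
as `m`, so that `j` is the product of its complementary divisor with an integer prime to `m`. -/
theorem exists_coprime_mul_div_of_not_ordProj_dvd {m j : ℕ} (hm : 0 < m)
    (hj : ∀ p ∈ m.primeFactors, ¬ p ^ m.factorization p ∣ j) :
    ∃ m' k : ℕ, m' ∣ m ∧ m'.primeFactors = m.primeFactors ∧ k.Coprime m ∧ j = k * (m / m') := by
  have hgm : m.gcd j ∣ m := Nat.gcd_dvd_left m j
  have hg : 0 < m.gcd j := Nat.gcd_pos_of_pos_left _ hm
  have hdvd : ∀ p, p.Prime → p ∣ m → p ∣ m / m.gcd j := by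
    intro p hp hpm
    by_contra h
    refine hj p (Nat.mem_primeFactors.2 ⟨hp, hpm, hm.ne'⟩) (dvd_trans ?_ (Nat.gcd_dvd_right m j))
    refine (Nat.Coprime.pow_left _ (hp.coprime_iff_not_dvd.2 h)).dvd_of_dvd_mul_right
      (m := m.gcd j) ?_
    rw [Nat.mul_div_cancel' hgm]
    exact Nat.ordProj_dvd m p
  refine ⟨m / m.gcd j, j / m.gcd j, Nat.div_dvd_of_dvd hgm, ?_, ?_, ?_⟩
  · refine (Nat.primeFactors_mono (Nat.div_dvd_of_dvd hgm) hm.ne').antisymm fun p hp => ?_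
    have hpp := Nat.prime_of_mem_primeFactors hp
    exact Nat.mem_primeFactors.2 ⟨hpp, hdvd p hpp (Nat.dvd_of_mem_primeFactors hp),
      (Nat.div_pos (Nat.le_of_dvd hm hgm) hg).ne'⟩
  · refine Nat.Coprime.symm (Nat.coprime_of_dvd fun p hp hpm hpk => ?_)
    exact Nat.not_coprime_of_dvd_of_dvd hp.one_lt (hdvd p hp hpm) hpk
      (Nat.coprime_div_gcd_div_gcd hg)
  · rw [Nat.div_div_self hgm hm.ne', Nat.div_mul_cancel (Nat.gcd_dvd_right m j)]

/-- If the `m`-th cyclotomic polynomial is irreducible over `K` and `L = K(ζ)`, every primitive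
`m`-th root of unity `ζ ^ k` is a Galois conjugate of `ζ`. -/
theorem IsPrimitiveRoot.exists_algEquiv_apply_eq_pow {m k : ℕ} [NeZero m] {K L : Type*} [Field K]
    [Field L] [Algebra K L] {ζ : L} (hζ : IsPrimitiveRoot ζ m)
    (hirr : Irreducible (Polynomial.cyclotomic m K))
    (hgen : IntermediateField.adjoin K {ζ} = ⊤) (hk : k.Coprime m) :
    ∃ σ : L ≃ₐ[K] L, σ ζ = ζ ^ k := by
  have : NeZero (m : L) := hζ.neZero'
  have : NeZero ((m : ℕ) : K) := NeZero.of_map (algebraMap K L) (neZero := by rwa [map_natCast])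
  have hroot {ξ : L} (hξ : IsPrimitiveRoot ξ m) :
      Polynomial.aeval ξ (Polynomial.cyclotomic m K) = 0 := by
    rw [Polynomial.aeval_def, Polynomial.eval₂_eq_eval_map, Polynomial.map_cyclotomic]
    exact hξ.isRoot_cyclotomic (NeZero.pos m)
  have hint : IsIntegral K ζ := ⟨_, Polynomial.cyclotomic.monic m K, hroot hζ⟩
  have htop := (IntermediateField.adjoin_simple_eq_top_iff_of_isAlgebraic hint.isAlgebraic).1 hgen
  have : IsCyclotomicExtension {m} K L := (hζ.adjoin_isCyclotomicExtension K).equiv _ _ _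
    ((Subalgebra.equivOfEq _ _ htop).trans Subalgebra.topEquiv)
  have : IsGalois K L := IsCyclotomicExtension.isGalois {m} K L
  refine minpoly.exists_algEquiv_of_root' hint.isAlgebraic ?_
  rw [← hζ.minpoly_eq_cyclotomic_of_irreducible hirr]
  exact hroot (hζ.pow_of_coprime k hk)

/-- The global generation statement from the proof of Lemma 3.6 (lem:19): for `ζ` a
primitive `m`-th root of unity and `L = ℚ(ζ)`, the `ℤ`-submodule of `L` spanned by the
elements `σ(ζ^{m/m'})`, for `σ ∈ Gal(ℚ(μ_m)/ℚ)` and `m'` a divisor of `m` with the same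
prime divisors as `m`, equals `ℤ[ζ]`; i.e. `ℤ[μ_m]` is generated over
`ℤ[Gal(ℚ(μ_m)/ℚ)]` by the `ζ^{m/m'}` with `m' ∈ 𝒜(m)`. -/
theorem stmt13 (m : ℕ) (hm : 0 < m)
    (L : Type*) [Field L] [Algebra ℚ L]
    (ζ : L) (hζ : IsPrimitiveRoot ζ m)
    (hgen : IntermediateField.adjoin ℚ {ζ} = ⊤) :
    Submodule.span ℤ {x : L | ∃ (σ : L ≃ₐ[ℚ] L) (m' : ℕ), m' ∣ m ∧
        m'.primeFactors = m.primeFactors ∧ x = σ (ζ ^ (m / m'))}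
      = Subalgebra.toSubmodule (Algebra.adjoin ℤ ({ζ} : Set L)) := by
  have : NeZero m := ⟨hm.ne'⟩
  apply le_antisymm
  · rw [Submodule.span_le]
    rintro _ ⟨σ, m', -, -, rfl⟩
    obtain ⟨i, -, hi⟩ := hζ.eq_pow_of_pow_eq_one
      (show σ ζ ^ m = 1 by rw [← map_pow, hζ.pow_eq_one, map_one])
    rw [map_pow, ← hi]
    exact pow_mem (pow_mem (Algebra.self_mem_adjoin_singleton ℤ ζ) i) _
  · rw [Algebra.adjoin_eq_span, Submodule.span_le]
    intro x hx
    obtain ⟨j, rfl⟩ := Submonoid.mem_closure_singleton.1 hx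
    clear hx
    induction hn : (m.primeFactors.filter fun q => q ^ m.factorization q ∣ j).card
      using Nat.strong_induction_on generalizing j with
    | _ n ih =>
    by_cases hbad : ∃ p ∈ m.primeFactors, p ^ m.factorization p ∣ j
    · obtain ⟨p, hp, hpj⟩ := hbad
      have hpp := Nat.prime_of_mem_primeFactors hp
      have hω : IsPrimitiveRoot (ζ ^ (m / p)) p :=
        hζ.pow hm (Nat.div_mul_cancel (Nat.dvd_of_mem_primeFactors hp)).symm
      have hsum := hω.geom_sum_eq_zero hpp.one_lt
      obtain ⟨r, rfl⟩ : ∃ r, p = r + 1 := ⟨p - 1, (Nat.sub_add_cancel hpp.one_le).symm⟩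
      rw [Finset.sum_range_succ', pow_zero] at hsum
      have heq : ζ ^ j = -∑ i ∈ Finset.range r, ζ ^ (j + m / (r + 1) * (i + 1)) := by
        simp_rw [pow_add ζ j, pow_mul ζ, ← Finset.mul_sum]
        rw [eq_neg_of_add_eq_zero_left hsum]
        ring
      rw [heq]
      refine neg_mem (sum_mem fun i hi => ih _ ?_ _ rfl)
      rw [filter_ordProj_dvd_add_div_mul hm hp hpj i.succ_pos (by simpa using hi), ← hn]
      exact Finset.card_erase_lt_of_mem (Finset.mem_filter.2 ⟨hp, hpj⟩)
    · push Not at hbad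
      obtain ⟨m', k, hm', hpf, hk, rfl⟩ := exists_coprime_mul_div_of_not_ordProj_dvd hm hbad
      obtain ⟨σ, hσ⟩ := hζ.exists_algEquiv_apply_eq_pow
        (Polynomial.cyclotomic.irreducible_rat hm) hgen hk
      exact Submodule.subset_span ⟨σ, m', hm', hpf, by rw [map_pow, hσ, pow_mul]⟩
end

section
/- Let p be a prime and a ∈ ℤ_p with p ∣ a. Define c_{−1} = 0, c_0 = 1 and, for j ≥ 1, c_j = p^{−1}(a·c_{j−1} − c_{j−2}) ∈ ℚ_p. Then for every j ≥ 0 one has p^{⌊j/2⌋}·c_j ∈ ℤ_p. In particular p^j·c_j → 0 p-adically as j → ∞. -/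
theorem norm_pow_half_mul_le_one {p : ℕ} [Fact p.Prime] {b : ℤ_[p]} {c : ℕ → ℚ_[p]}
    (hc0 : c 0 = 1) (hc1 : c 1 = b)
    (hrec : ∀ j : ℕ, c (j + 2) = b * c (j + 1) - (p : ℚ_[p])⁻¹ * c j) (j : ℕ) :
    ‖(p : ℚ_[p]) ^ (j / 2) * c j‖ ≤ 1 := by
  have hp : (p : ℚ_[p]) ≠ 0 := Nat.cast_ne_zero.mpr (Fact.out : p.Prime).ne_zero
  have hp_mem : (p : ℚ_[p]) ∈ PadicInt.subring p := natCast_mem _ p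
  have hb_mem : (b : ℚ_[p]) ∈ PadicInt.subring p := b.2
  change (p : ℚ_[p]) ^ (j / 2) * c j ∈ PadicInt.subring p
  induction j using Nat.twoStepInduction with
  | zero => simp [hc0, one_mem]
  | one => simpa [hc1] using hb_mem
  | more j ih₀ ih₁ =>
    have key : (p : ℚ_[p]) ^ ((j + 2) / 2) * c (j + 2) =
        b * ((p : ℚ_[p]) ^ (j / 2 + 1 - (j + 1) / 2) * ((p : ℚ_[p]) ^ ((j + 1) / 2) * c (j + 1)))
          - (p : ℚ_[p]) ^ (j / 2) * c j := by
      rw [← mul_assoc (_ ^ _) (_ ^ _), ← pow_add,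
        show j / 2 + 1 - (j + 1) / 2 + (j + 1) / 2 = j / 2 + 1 by omega,
        show (j + 2) / 2 = j / 2 + 1 by omega, hrec]
      field_simp
      ring
    rw [key]
    exact sub_mem (mul_mem hb_mem (mul_mem (pow_mem hp_mem _) ih₁)) ih₀

theorem tendsto_pow_mul_of_norm_pow_half_mul_le_one {p : ℕ} [Fact p.Prime] {c : ℕ → ℚ_[p]}
    (h : ∀ j : ℕ, ‖(p : ℚ_[p]) ^ (j / 2) * c j‖ ≤ 1) :
    Filter.Tendsto (fun j : ℕ => (p : ℚ_[p]) ^ j * c j) Filter.atTop (nhds 0) := by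
  have hexp : Filter.Tendsto (fun j : ℕ => j - j / 2) Filter.atTop Filter.atTop :=
    Filter.tendsto_atTop_atTop.mpr fun n => ⟨2 * n, fun j hj => by omega⟩
  refine squeeze_zero_norm (fun j => ?_)
    ((tendsto_pow_atTop_nhds_zero_of_lt_one (norm_nonneg (p : ℚ_[p]))
      Padic.norm_p_lt_one).comp hexp)
  have hsplit : (p : ℚ_[p]) ^ j * c j =
      (p : ℚ_[p]) ^ (j - j / 2) * ((p : ℚ_[p]) ^ (j / 2) * c j) := by
    rw [← mul_assoc, ← pow_add, Nat.sub_add_cancel (Nat.div_le_self j 2)]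
  rw [hsplit, norm_mul, norm_pow]
  exact mul_le_of_le_one_right (by positivity) (h j)

/-- Definition 3.9 / proof of Proposition 3.10: for `p ∣ a`, the sequence
`c_{−1} = 0`, `c_0 = 1`, `c_j = p⁻¹(a·c_{j−1} − c_{j−2})` satisfies
`p^{⌊j/2⌋}·c_j ∈ ℤ_p` for all `j ≥ 0`; in particular `p^j·c_j → 0` `p`-adically. -/
theorem stmt14 (p : ℕ) [Fact p.Prime] (a : ℤ_[p]) (ha : (p : ℤ_[p]) ∣ a)
    (c : ℕ → ℚ_[p]) (hc0 : c 0 = 1) (hc1 : c 1 = (a : ℚ_[p]) / p)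
    (hrec : ∀ j : ℕ, c (j + 2) = (p : ℚ_[p])⁻¹ * ((a : ℚ_[p]) * c (j + 1) - c j)) :
    (∀ j : ℕ, ‖(p : ℚ_[p]) ^ (j / 2) * c j‖ ≤ 1) ∧
    Filter.Tendsto (fun j : ℕ => (p : ℚ_[p]) ^ j * c j) Filter.atTop (nhds 0) := by
  have hp : (p : ℚ_[p]) ≠ 0 := Nat.cast_ne_zero.mpr (Fact.out : p.Prime).ne_zero
  obtain ⟨b, rfl⟩ := ha
  have hint := norm_pow_half_mul_le_one (b := b) hc0
    (by rw [hc1]; push_cast; field_simp)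
    (fun j => by rw [hrec]; push_cast; field_simp)
  exact ⟨hint, tendsto_pow_mul_of_norm_pow_half_mul_le_one hint⟩
end
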